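/- Let τ lie in the complex upper half-plane and set x = v(τ), y = v(2τ). Then x²·y + x² + y² = y. -/

import Mathlib

/-- `qpow τ r = exp(2πi·r·τ)`, i.e. `q^r` where `q = exp(2πiτ)`. -/
noncomputable def qpow (τ : ℂ) (r : ℝ) : ℂ :=
  Complex.exp (2 * (Real.pi : ℂ) * Complex.I * (r : ℂ) * τ)

/-- The Kronecker symbol `(2/n)`: `+1` if `n ≡ ±1 (mod 8)`, `-1` if `n ≡ ±3 (mod 8)`,
`0` if `n` is even. -/
def chi8 (n : ℕ) : ℤ :=
  if n % 8 = 1 ∨ n % 8 = 7 then 1 else if n % 8 = 3 ∨ n % 8 = 5 then -1 else 0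

/-- Ramanujan's continued fraction value
`v(τ) = q^{1/2} ∏_{n≥1} (1 - q^n)^{χ₈(n)}`, `q = exp(2πiτ)`. -/
noncomputable def vRam (τ : ℂ) : ℂ :=
  qpow τ (1/2) * ∏' n : ℕ, (1 - qpow τ ((n : ℝ) + 1)) ^ chi8 (n + 1)

open Filter Topology Finset

/-- The infinite `q`-Pochhammer symbol `(a; p)_∞ = ∏_{k ≥ 0} (1 - a p^k)`. -/
noncomputable def qPochInf (a p : ℂ) : ℂ := ∏' k : ℕ, (1 - a * p ^ k)

section qPochInf

variable {a p : ℂ}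

lemma summable_norm_neg_mul_pow (a : ℂ) (hp : ‖p‖ < 1) :
    Summable fun k : ℕ ↦ ‖-(a * p ^ k)‖ := by
  simpa [norm_mul, norm_pow] using (summable_geometric_of_lt_one (norm_nonneg p) hp).mul_left ‖a‖

lemma multipliable_qPochInf (a : ℂ) (hp : ‖p‖ < 1) :
    Multipliable fun k : ℕ ↦ (1 - a * p ^ k) := by
  simpa [sub_eq_add_neg] using multipliable_one_add_of_summable (summable_norm_neg_mul_pow a hp)

lemma hasProd_qPochInf (a : ℂ) (hp : ‖p‖ < 1) :
    HasProd (fun k : ℕ ↦ (1 - a * p ^ k)) (qPochInf a p) :=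
  (multipliable_qPochInf a hp).hasProd

lemma one_sub_mul_pow_ne_zero (ha : ‖a‖ < 1) (hp : ‖p‖ < 1) (k : ℕ) : 1 - a * p ^ k ≠ 0 := by
  refine sub_ne_zero.mpr fun h ↦ ?_
  have h1 : ‖a * p ^ k‖ < 1 := by
    rw [norm_mul, norm_pow]
    exact mul_lt_one_of_nonneg_of_lt_one_left (norm_nonneg _) ha
      (pow_le_one₀ (norm_nonneg _) hp.le)
  rw [← h] at h1
  simp at h1

lemma qPochInf_ne_zero (ha : ‖a‖ < 1) (hp : ‖p‖ < 1) : qPochInf a p ≠ 0 := by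
  have h := tprod_one_add_ne_zero_of_summable (f := fun k : ℕ ↦ -(a * p ^ k))
    (fun k ↦ by simpa [sub_eq_add_neg] using one_sub_mul_pow_ne_zero ha hp k)
    (summable_norm_neg_mul_pow a hp)
  simpa [qPochInf, sub_eq_add_neg] using h

lemma qPochInf_eq_mul_sq (a : ℂ) (hp : ‖p‖ < 1) :
    qPochInf a p = qPochInf a (p ^ 2) * qPochInf (a * p) (p ^ 2) := by
  have hp2 : ‖p ^ 2‖ < 1 := by
    rw [norm_pow]; exact pow_lt_one₀ (norm_nonneg _) hp two_ne_zero
  refine (hasProd_qPochInf a hp).unique (HasProd.even_mul_odd ?_ ?_)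
  · convert hasProd_qPochInf a hp2 using 2 with k
    rw [pow_mul]
  · convert hasProd_qPochInf (a * p) hp2 using 2 with k
    ring

lemma qPochInf_mul_neg (a : ℂ) (hp : ‖p‖ < 1) :
    qPochInf a p * qPochInf (-a) p = qPochInf (a ^ 2) (p ^ 2) := by
  have hp2 : ‖p ^ 2‖ < 1 := by
    rw [norm_pow]; exact pow_lt_one₀ (norm_nonneg _) hp two_ne_zero
  refine ((hasProd_qPochInf a hp).mul (hasProd_qPochInf (-a) hp)).unique ?_
  convert hasProd_qPochInf (a ^ 2) hp2 using 2 with k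
  ring

end qPochInf

/-- Gaussian binomial coefficients, evaluated at a complex number. -/
noncomputable def gaussBinom (p : ℂ) : ℕ → ℕ → ℂ
  | _, 0 => 1
  | 0, _ + 1 => 0
  | n + 1, j + 1 => p ^ (j + 1) * gaussBinom p n (j + 1) + gaussBinom p n j

/-- The finite `q`-Pochhammer symbol `(p; p)_n`. -/
noncomputable def qPochFin (p : ℂ) (n : ℕ) : ℂ := ∏ k ∈ range n, (1 - p * p ^ k)

section gaussBinom

variable {p : ℂ}

@[simp] lemma gaussBinom_zero_right (p : ℂ) (n : ℕ) : gaussBinom p n 0 = 1 := by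
  cases n <;> rfl

lemma gaussBinom_eq_zero_of_lt {n j : ℕ} (h : n < j) : gaussBinom p n j = 0 := by
  induction n generalizing j with
  | zero => cases j with
    | zero => omega
    | succ j => rfl
  | succ n ih => cases j with
    | zero => omega
    | succ j => simp [gaussBinom, ih (j := j + 1) (by omega), ih (j := j) (by omega)]

lemma gaussBinom_self (p : ℂ) (n : ℕ) : gaussBinom p n n = 1 := by
  induction n with
  | zero => rfl
  | succ n ih => simp [gaussBinom, ih, gaussBinom_eq_zero_of_lt]

lemma gaussBinom_mul_qPochFin (p : ℂ) (a b : ℕ) :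
    gaussBinom p (a + b) a * (qPochFin p a * qPochFin p b) = qPochFin p (a + b) := by
  induction a generalizing b with
  | zero => simp [qPochFin]
  | succ a iha =>
    induction b with
    | zero => simp [gaussBinom_self, qPochFin]
    | succ b ihb =>
      have h1 := iha (b + 1)
      have ha : qPochFin p (a + 1) = qPochFin p a * (1 - p * p ^ a) := prod_range_succ _ _
      have hb : qPochFin p (b + 1) = qPochFin p b * (1 - p * p ^ b) := prod_range_succ _ _
      have hab : qPochFin p (a + 1 + b + 1) = qPochFin p (a + 1 + b) * (1 - p * p ^ (a + 1 + b)) :=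
        prod_range_succ _ _
      rw [show a + (b + 1) = a + 1 + b by ring] at h1
      rw [show a + 1 + (b + 1) = a + 1 + b + 1 by ring, hab, gaussBinom]
      linear_combination (p ^ (a + 1) * (1 - p * p ^ b)) * ihb + (1 - p * p ^ a) * h1
        + gaussBinom p (a + 1 + b) (a + 1) * p ^ (a + 1) * qPochFin p (a + 1) * hb
        + gaussBinom p (a + 1 + b) a * qPochFin p (b + 1) * ha

/-- The `q`-binomial theorem. -/
lemma prod_one_add_mul_pow_eq_sum (r x : ℂ) (n : ℕ) :
    ∏ k ∈ range n, (1 + x * r ^ (2 * k + 1)) =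
      ∑ j ∈ range (n + 1), r ^ (j ^ 2) * gaussBinom (r ^ 2) n j * x ^ j := by
  induction n generalizing x with
  | zero => simp
  | succ n ih =>
    have h : ∀ k, 1 + x * r ^ (2 * (k + 1) + 1) = 1 + (x * r ^ 2) * r ^ (2 * k + 1) := by
      intro k; ring
    rw [prod_range_succ']
    simp only [h]
    rw [ih]
    set b : ℕ → ℂ := fun j ↦ r ^ (j ^ 2) * gaussBinom (r ^ 2) n j * (x * r ^ 2) ^ j with hb
    have hb_last : b (n + 1) = 0 := by simp [hb, gaussBinom_eq_zero_of_lt]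
    have hstep : ∀ j, r ^ ((j + 1) ^ 2) * gaussBinom (r ^ 2) (n + 1) (j + 1) * x ^ (j + 1) =
        b (j + 1) + x * r * b j := by
      intro j
      simp only [hb, gaussBinom]
      ring
    have hshift : ∑ j ∈ range (n + 1), b (j + 1) + 1 = ∑ j ∈ range (n + 1), b j := by
      have h1 := sum_range_succ' b (n + 1)
      rw [sum_range_succ, hb_last] at h1
      simpa [hb] using h1.symm
    rw [sum_range_succ' _ (n + 1)]
    simp only [hstep, sum_add_distrib, ← mul_sum]
    simp only [gaussBinom_zero_right]
    linear_combination -hshift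

lemma tendsto_qPochFin (hp : ‖p‖ < 1) :
    Tendsto (qPochFin p) atTop (𝓝 (qPochInf p p)) :=
  (hasProd_qPochInf p hp).tendsto_prod_nat

lemma qPochFin_ne_zero (hp : ‖p‖ < 1) (n : ℕ) : qPochFin p n ≠ 0 :=
  prod_ne_zero_iff.mpr fun k _ ↦ one_sub_mul_pow_ne_zero hp hp k

lemma gaussBinom_add_eq (hp : ‖p‖ < 1) (a b : ℕ) :
    gaussBinom p (a + b) a = qPochFin p (a + b) * ((qPochFin p a)⁻¹ * (qPochFin p b)⁻¹) := by
  rw [← gaussBinom_mul_qPochFin]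
  have := qPochFin_ne_zero hp a
  have := qPochFin_ne_zero hp b
  field_simp

lemma exists_norm_gaussBinom_le (hp : ‖p‖ < 1) : ∃ K : ℝ, ∀ n j, ‖gaussBinom p n j‖ ≤ K := by
  have h := tendsto_qPochFin hp
  obtain ⟨A, hA⟩ := (Metric.isBounded_range_of_tendsto _ h).exists_norm_le
  obtain ⟨B, hB⟩ := (Metric.isBounded_range_of_tendsto _
    (h.inv₀ (qPochInf_ne_zero hp hp))).exists_norm_le
  have hA' : ∀ n, ‖qPochFin p n‖ ≤ A := fun n ↦ hA _ ⟨n, rfl⟩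
  have hB' : ∀ n, ‖(qPochFin p n)⁻¹‖ ≤ B := fun n ↦ hB _ ⟨n, rfl⟩
  have hA0 : 0 ≤ A := (norm_nonneg _).trans (hA' 0)
  have hB0 : 0 ≤ B := (norm_nonneg _).trans (hB' 0)
  refine ⟨A * (B * B), fun n j ↦ ?_⟩
  rcases lt_or_ge n j with hnj | hnj
  · rw [gaussBinom_eq_zero_of_lt hnj, norm_zero]
    positivity
  · obtain ⟨b, rfl⟩ := Nat.exists_eq_add_of_le hnj
    rw [gaussBinom_add_eq hp, norm_mul, norm_mul]
    gcongr
    exacts [hA' _, hB' _, hB' _]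

end gaussBinom

section theta

variable {r w : ℂ}

lemma summable_norm_theta (hr0 : r ≠ 0) (hr : ‖r‖ < 1) (hw : w ≠ 0) :
    Summable fun m : ℤ ↦ ‖r ^ (m ^ 2) * w ^ m‖ := by
  have hpi : (Real.pi : ℂ) ≠ 0 := by exact_mod_cast Real.pi_ne_zero
  have him : 0 < (Complex.log r / (Real.pi * Complex.I)).im := by
    have : (Complex.log r / (Real.pi * Complex.I)).im = - Real.log ‖r‖ / Real.pi := by
      rw [show Complex.log r / (Real.pi * Complex.I) =
        -(Complex.log r * Complex.I) * ((Real.pi⁻¹ : ℝ) : ℂ) by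
          push_cast; field_simp; simp, Complex.im_mul_ofReal]
      simp [Complex.log_re]; ring
    rw [this]
    exact div_pos (neg_pos.mpr (Real.log_neg (norm_pos_iff.mpr hr0) hr)) Real.pi_pos
  have h := ((summable_jacobiTheta₂_term_iff (Complex.log w / (2 * Real.pi * Complex.I)) _).mpr
    him).norm
  refine h.congr fun m ↦ congrArg norm ?_
  rw [jacobiTheta₂_term, Complex.exp_add]
  conv_rhs => rw [← Complex.exp_log hr0, ← Complex.exp_log hw]
  rw [← Complex.exp_int_mul, ← Complex.exp_int_mul, mul_comm]
  congr 2 <;> push_cast <;> field_simp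

/-- The finite form of Jacobi's triple product identity. -/
lemma prod_mul_prod_eq_sum (hr0 : r ≠ 0) (hw : w ≠ 0) (n : ℕ) :
    ∏ k ∈ range n, ((1 + w * r ^ (2 * k + 1)) * (1 + w⁻¹ * r ^ (2 * k + 1))) =
      ∑ j ∈ range (n + n + 1), gaussBinom (r ^ 2) (n + n) j *
        (r ^ (((j : ℤ) - n) ^ 2) * w ^ ((j : ℤ) - n)) := by
  have h := prod_one_add_mul_pow_eq_sum r (w * (r ^ (2 * n))⁻¹) (n + n)
  have h1 : ∏ k ∈ range n, (1 + w * (r ^ (2 * n))⁻¹ * r ^ (2 * k + 1)) =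
      w ^ n * (r ^ (n ^ 2))⁻¹ * ∏ k ∈ range n, (1 + w⁻¹ * r ^ (2 * k + 1)) := by
    have h2 : ∏ k ∈ range n, (w * (r ^ (2 * k + 1))⁻¹) = w ^ n * (r ^ (n ^ 2))⁻¹ := by
      clear h
      induction n with
      | zero => simp
      | succ n ih => rw [prod_range_succ, ih]; field_simp; ring
    rw [← h2, ← prod_mul_distrib, ← prod_range_reflect]
    refine prod_congr rfl fun k hk ↦ ?_
    obtain ⟨m, rfl⟩ := Nat.exists_eq_add_of_lt (mem_range.mp hk)
    rw [show k + m + 1 - 1 - k = m by omega]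
    field_simp
    ring
  have h3 : ∏ k ∈ range n, (1 + w * (r ^ (2 * n))⁻¹ * r ^ (2 * (n + k) + 1)) =
      ∏ k ∈ range n, (1 + w * r ^ (2 * k + 1)) := by
    refine prod_congr rfl fun k _ ↦ ?_
    field_simp
    ring
  rw [prod_range_add, h1, h3] at h
  have h4 : ∏ k ∈ range n, ((1 + w * r ^ (2 * k + 1)) * (1 + w⁻¹ * r ^ (2 * k + 1))) =
      (w ^ n)⁻¹ * r ^ (n ^ 2) * ∑ j ∈ range (n + n + 1),
        r ^ (j ^ 2) * gaussBinom (r ^ 2) (n + n) j * (w * (r ^ (2 * n))⁻¹) ^ j := by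
    rw [← h, prod_mul_distrib]
    field_simp
  rw [h4, mul_sum]
  refine sum_congr rfl fun j _ ↦ ?_
  rw [zpow_sub₀ hw, show ((j : ℤ) - n) ^ 2 = ((j ^ 2 + n ^ 2 : ℕ) : ℤ) - ((2 * n * j : ℕ) : ℤ) by
    push_cast; ring, zpow_sub₀ hr0]
  simp only [zpow_natCast, pow_add, mul_pow, inv_pow, ← pow_mul]
  field_simp

/-- Jacobi's triple product identity. -/
lemma hasSum_theta (hr0 : r ≠ 0) (hr : ‖r‖ < 1) (hw : w ≠ 0) :
    HasSum (fun m : ℤ ↦ r ^ (m ^ 2) * w ^ m)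
      (qPochInf (r ^ 2) (r ^ 2) *
        (qPochInf (-(w * r)) (r ^ 2) * qPochInf (-(w⁻¹ * r)) (r ^ 2))) := by
  have hp : ‖r ^ 2‖ < 1 := by
    rw [norm_pow]; exact pow_lt_one₀ (norm_nonneg _) hr two_ne_zero
  set P := qPochInf (r ^ 2) (r ^ 2) with hP
  have hP0 : P ≠ 0 := qPochInf_ne_zero hp hp
  have hsum := summable_norm_theta hr0 hr hw
  obtain ⟨K, hK⟩ := exists_norm_gaussBinom_le hp
  have hK0 : 0 ≤ K := (norm_nonneg _).trans (hK 0 0)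
  let c : ℕ → ℤ → ℂ := fun n m ↦
    if -(n : ℤ) ≤ m then gaussBinom (r ^ 2) (n + n) (m + n).toNat else 0
  have hc : ∀ m, Tendsto (c · m) atTop (𝓝 P⁻¹) := by
    intro m
    have hT := tendsto_qPochFin hp
    have e1 : Tendsto (fun n : ℕ ↦ n + n) atTop atTop := tendsto_id.atTop_add_atTop tendsto_id
    have e2 : ∀ m : ℤ, Tendsto (fun n : ℕ ↦ (m + n).toNat) atTop atTop := by
      intro m
      refine tendsto_atTop_mono (f := fun n : ℕ ↦ n - m.natAbs) (fun n ↦ by omega)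
        (tendsto_sub_atTop_nat _)
    have hlim := (hT.comp e1).mul (((hT.comp (e2 m)).inv₀ hP0).mul ((hT.comp (e2 (-m))).inv₀ hP0))
    have hval : P * (P⁻¹ * P⁻¹) = P⁻¹ := by field_simp
    rw [← hP, hval] at hlim
    refine hlim.congr' ?_
    filter_upwards [eventually_ge_atTop m.natAbs] with n hn
    have hn1 : -(n : ℤ) ≤ m := by omega
    have hn2 : n + n = (m + n).toNat + (-m + n).toNat := by omega
    simp only [Function.comp_apply, c, if_pos hn1]
    conv_rhs => rw [hn2]
    rw [gaussBinom_add_eq hp, ← hn2]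
  have hfin : ∀ n, HasSum (fun m : ℤ ↦ c n m * (r ^ (m ^ 2) * w ^ m))
      (∏ k ∈ range n, ((1 + w * r ^ (2 * k + 1)) * (1 + w⁻¹ * r ^ (2 * k + 1)))) := by
    intro n
    have hinj : Function.Injective fun j : ℕ ↦ (j : ℤ) - n := fun a b h ↦ by
      simpa using h
    rw [prod_mul_prod_eq_sum hr0 hw, ← hinj.hasSum_iff]
    · have : ∀ j : ℕ, c n ((j : ℤ) - n) = gaussBinom (r ^ 2) (n + n) j := by
        intro j
        simp [c]
      simp only [Function.comp_def, this]
      refine hasSum_sum_of_ne_finset_zero fun j hj ↦ ?_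
      rw [gaussBinom_eq_zero_of_lt (by simpa using hj), zero_mul]
    · intro m hm
      have : ¬ -(n : ℤ) ≤ m := fun h ↦ hm ⟨(m + n).toNat, by simp; omega⟩
      simp [c, this]
  have htend := tendsto_tsum_of_dominated_convergence (𝓕 := atTop) (hsum.mul_left K)
    (fun m ↦ (hc m).mul_const (r ^ (m ^ 2) * w ^ m))
    (Eventually.of_forall fun n m ↦ by
      rw [norm_mul]
      gcongr
      simp only [c]
      split_ifs
      · exact hK _ _
      · simpa using hK0)
  simp only [(hfin _).tsum_eq, tsum_mul_left] at htend
  have hprod := ((hasProd_qPochInf (-(w * r)) hp).mul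
    (hasProd_qPochInf (-(w⁻¹ * r)) hp)).tendsto_prod_nat
  have heq := tendsto_nhds_unique htend (hprod.congr fun n ↦ prod_congr rfl fun k _ ↦ by ring)
  have hs := hsum.of_norm.hasSum
  rw [← heq, mul_inv_cancel_left₀ hP0]
  exact hs

end theta

/-- Splitting the theta series into its terms of even and odd index. -/
lemma theta_dissection {r w : ℂ} (hr0 : r ≠ 0) (hr : ‖r‖ < 1) (hw : w ≠ 0) :
    qPochInf (r ^ 2) (r ^ 2) * (qPochInf (-(w * r)) (r ^ 2) * qPochInf (-(w⁻¹ * r)) (r ^ 2)) =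
      qPochInf (r ^ 8) (r ^ 8) *
        (qPochInf (-(w ^ 2 * r ^ 4)) (r ^ 8) * qPochInf (-((w ^ 2)⁻¹ * r ^ 4)) (r ^ 8)) +
      w * r * (qPochInf (r ^ 8) (r ^ 8) *
        (qPochInf (-(w ^ 2 * r ^ 8)) (r ^ 8) * qPochInf (-(w ^ 2)⁻¹) (r ^ 8))) := by
  have hr4 : ‖r ^ 4‖ < 1 := by
    rw [norm_pow]; exact pow_lt_one₀ (norm_nonneg _) hr four_ne_zero
  have heven := hasSum_theta (pow_ne_zero 4 hr0) hr4 (pow_ne_zero 2 hw)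
  have hodd := (hasSum_theta (pow_ne_zero 4 hr0) hr4
    (mul_ne_zero (pow_ne_zero 2 hw) (pow_ne_zero 4 hr0))).mul_left (w * r)
  have e1 : w ^ 2 * r ^ 4 * r ^ 4 = w ^ 2 * r ^ 8 := by ring
  have e2 : (w ^ 2 * r ^ 4)⁻¹ * r ^ 4 = (w ^ 2)⁻¹ := by field_simp
  rw [e1, e2] at hodd
  simp only [← pow_mul] at heven hodd
  refine (hasSum_theta hr0 hr hw).unique ?_
  set f : ℤ → ℂ := fun m ↦ r ^ (m ^ 2) * w ^ m with hf
  have hinj : Function.Injective fun k : ℤ ↦ 2 * k := fun a b h ↦ by simpa using h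
  have hinj' : Function.Injective fun k : ℤ ↦ 2 * k + 1 := fun a b h ↦ by simpa using h
  have hcompl : IsCompl (Set.range fun k : ℤ ↦ 2 * k) (Set.range fun k : ℤ ↦ 2 * k + 1) := by
    have h0 : (Set.range fun k : ℤ ↦ 2 * k) = {n | Even n} := Set.ext fun n ↦
      ⟨by rintro ⟨k, rfl⟩; exact even_two_mul k, by rintro ⟨k, hk⟩; exact ⟨k, by dsimp only; omega⟩⟩
    have h1 : (Set.range fun k : ℤ ↦ 2 * k + 1) = {n | Odd n} := Set.ext fun n ↦
      ⟨by rintro ⟨k, rfl⟩; exact odd_two_mul_add_one k, by rintro ⟨k, hk⟩; exact ⟨k, hk.symm⟩⟩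
    rw [h0, h1]
    exact Int.isCompl_even_odd
  have hfe : (f ∘ fun k : ℤ ↦ 2 * k) = fun k : ℤ ↦ (r ^ 4) ^ (k ^ 2) * (w ^ 2) ^ k := by
    funext k
    simp only [hf, Function.comp_apply]
    rw [← zpow_natCast r, ← zpow_natCast w, ← zpow_mul, ← zpow_mul]
    congr 2
    push_cast
    ring
  have hfo : (f ∘ fun k : ℤ ↦ 2 * k + 1) =
      fun k : ℤ ↦ w * r * ((r ^ 4) ^ (k ^ 2) * (w ^ 2 * r ^ 4) ^ k) := by
    funext k
    simp only [hf, Function.comp_apply]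
    rw [mul_zpow, ← zpow_natCast r, ← zpow_natCast w, ← zpow_mul, ← zpow_mul, ← zpow_mul,
      show (2 * k + 1) ^ 2 = ((4 : ℕ) : ℤ) * k ^ 2 + ((4 : ℕ) : ℤ) * k + 1 by push_cast; ring,
      zpow_add_one₀ hr0, zpow_add₀ hr0, zpow_add_one₀ hw]
    push_cast
    ring
  refine HasSum.add_isCompl hcompl (hinj.hasSum_range_iff.mpr ?_) (hinj'.hasSum_range_iff.mpr ?_)
  · exact hfe ▸ heven
  · exact hfo ▸ hodd

lemma qpow_natCast_succ (τ : ℂ) (n : ℕ) : qpow τ ((n : ℝ) + 1) = qpow τ 1 ^ (n + 1) := by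
  rw [qpow, qpow, ← Complex.exp_nat_mul]
  push_cast
  ring_nf

lemma norm_qpow_one_lt {τ : ℂ} (hτ : 0 < τ.im) : ‖qpow τ 1‖ < 1 := by
  rw [qpow, Complex.norm_exp, Real.exp_lt_one_iff]
  simp
  positivity

/-- `v(τ)` as a quotient of infinite `q`-Pochhammer symbols. -/
lemma vRam_eq {τ : ℂ} (hτ : 0 < τ.im) {q : ℂ} (hq : qpow τ 1 = q) :
    vRam τ = qpow τ (1 / 2) * (qPochInf q (q ^ 8) * (qPochInf (q ^ 5) (q ^ 8))⁻¹ *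
      ((qPochInf (q ^ 3) (q ^ 8))⁻¹ * qPochInf (q ^ 7) (q ^ 8))) := by
  have hq1 : ‖q‖ < 1 := hq ▸ norm_qpow_one_lt hτ
  have hpow : ∀ n : ℕ, n ≠ 0 → ‖q ^ n‖ < 1 := fun n hn ↦ by
    rw [norm_pow]; exact pow_lt_one₀ (norm_nonneg _) hq1 hn
  have h8 := hpow 8 (by norm_num)
  have h1 := hasProd_qPochInf q h8
  have h3 : HasProd (fun k : ℕ ↦ (1 - q ^ 3 * (q ^ 8) ^ k)⁻¹) (qPochInf (q ^ 3) (q ^ 8))⁻¹ :=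
    (hasProd_qPochInf (q ^ 3) h8).inv₀ (qPochInf_ne_zero (hpow 3 (by norm_num)) h8)
  have h5 : HasProd (fun k : ℕ ↦ (1 - q ^ 5 * (q ^ 8) ^ k)⁻¹) (qPochInf (q ^ 5) (q ^ 8))⁻¹ :=
    (hasProd_qPochInf (q ^ 5) h8).inv₀ (qPochInf_ne_zero (hpow 5 (by norm_num)) h8)
  have h7 := hasProd_qPochInf (q ^ 7) h8
  rw [vRam]
  congr 1
  simp only [qpow_natCast_succ, hq]
  refine HasProd.tprod_eq ?_
  rw [← mul_one (_ * _)]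
  refine HasProd.even_mul_odd ?_ ?_
  · have hchi : ∀ k, chi8 (2 * (2 * (2 * k)) + 1) = 1 ∧ chi8 (2 * (2 * (2 * k + 1)) + 1) = -1 ∧
        chi8 (2 * (2 * (2 * k) + 1) + 1) = -1 ∧ chi8 (2 * (2 * (2 * k + 1) + 1) + 1) = 1 := by
      intro k
      unfold chi8
      refine ⟨?_, ?_, ?_, ?_⟩ <;> split_ifs <;> omega
    refine HasProd.even_mul_odd (HasProd.even_mul_odd ?_ ?_) (HasProd.even_mul_odd ?_ ?_)
    · convert h1 using 2 with k
      rw [(hchi k).1, zpow_one]; ring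
    · convert h5 using 2 with k
      rw [(hchi k).2.1, zpow_neg_one]; ring
    · convert h3 using 2 with k
      rw [(hchi k).2.2.1, zpow_neg_one]; ring
    · convert h7 using 2 with k
      rw [(hchi k).2.2.2, zpow_one]; ring
  · convert hasProd_one using 2 with k
    have : chi8 (2 * k + 1 + 1) = 0 := by unfold chi8; split_ifs <;> omega
    simp [this]

/-- If `τ` lies in the upper half-plane, `x = v(τ)` and `y = v(2τ)`,
then `x²y + x² + y² = y`. -/
theorem v_duplication (τ : ℂ) (hτ : 0 < τ.im) :
    vRam τ ^ 2 * vRam (2 * τ) + vRam τ ^ 2 + vRam (2 * τ) ^ 2 = vRam (2 * τ) := by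
  have hτ2 : 0 < (2 * τ).im := by simpa using hτ
  obtain ⟨q, hq⟩ : ∃ q, qpow τ 1 = q := ⟨_, rfl⟩
  have hq0 : q ≠ 0 := hq ▸ Complex.exp_ne_zero _
  have hq1 : ‖q‖ < 1 := hq ▸ norm_qpow_one_lt hτ
  have hhalf : qpow τ (1 / 2) ^ 2 = q := by
    rw [← hq, qpow, qpow, ← Complex.exp_nat_mul]
    push_cast
    ring_nf
  have hhalf2 : qpow (2 * τ) (1 / 2) = q := by
    rw [← hq, qpow, qpow]
    push_cast
    ring_nf
  have hqq : qpow (2 * τ) 1 = q ^ 2 := by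
    rw [← hq, qpow, qpow, ← Complex.exp_nat_mul]
    push_cast
    ring_nf
  have hpow : ∀ n : ℕ, n ≠ 0 → ‖q ^ n‖ < 1 := fun n hn ↦ by
    rw [norm_pow]; exact pow_lt_one₀ (norm_nonneg _) hq1 hn
  have h8 := hpow 8 (by norm_num)
  have h4 : ‖-q ^ 4‖ < 1 := by simpa using hpow 4 (by norm_num)
  have hr : ‖Complex.I * q ^ 2‖ < 1 := by simpa using hpow 2 (by norm_num)
  have hr0 : Complex.I * q ^ 2 ≠ 0 := mul_ne_zero Complex.I_ne_zero (pow_ne_zero 2 hq0)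
  have hw : Complex.I * q⁻¹ ≠ 0 := mul_ne_zero Complex.I_ne_zero (inv_ne_zero hq0)
  have key₁ := theta_dissection hr0 hr hw
  have key₂ := theta_dissection hr0 hr (neg_ne_zero.mpr hw)
  have hI8 : Complex.I ^ 8 = 1 := by rw [show 8 = 4 * 2 by rfl, pow_mul, Complex.I_pow_four, one_pow]
  have e1 : (Complex.I * q ^ 2) ^ 2 = -q ^ 4 := by
    rw [mul_pow, Complex.I_sq]; ring
  have e2 : (Complex.I * q ^ 2) ^ 4 = q ^ 8 := by
    rw [mul_pow, Complex.I_pow_four]; ring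
  have e3 : (Complex.I * q ^ 2) ^ 8 = q ^ 16 := by
    rw [mul_pow, hI8]; ring
  have e4 : Complex.I * q⁻¹ * (Complex.I * q ^ 2) = -q := by
    field_simp; simp
  have e5 : (Complex.I * q⁻¹)⁻¹ * (Complex.I * q ^ 2) = q ^ 3 := by
    field_simp
  have e6 : (Complex.I * q⁻¹) ^ 2 = -(q ^ 2)⁻¹ := by
    rw [mul_pow, Complex.I_sq]; simp
  have e7 : (q ^ 2)⁻¹ * q ^ 8 = q ^ 6 := by field_simp
  have e8 : (q ^ 2)⁻¹ * q ^ 16 = q ^ 14 := by field_simp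
  have e9 : q ^ 2 * q ^ 8 = q ^ 10 := by ring
  simp only [neg_sq, inv_neg, neg_mul, e1, e2, e3, e4, e5, e6, e7, e8, e9, inv_inv, neg_neg]
    at key₁ key₂
  have hsplit : ∀ a : ℂ, qPochInf a (-q ^ 4) =
      qPochInf a (q ^ 8) * qPochInf (-(a * q ^ 4)) (q ^ 8) := fun a ↦ by
    rw [qPochInf_eq_mul_sq a h4, show (-q ^ 4) ^ 2 = q ^ 8 by ring, mul_neg]
  have hsq : ∀ a : ℂ, qPochInf (a ^ 2) (q ^ 16) = qPochInf a (q ^ 8) * qPochInf (-a) (q ^ 8) :=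
    fun a ↦ by rw [qPochInf_mul_neg a h8, ← pow_mul]
  have hne : ∀ n, n ≠ 0 → qPochInf (q ^ n) (q ^ 8) ≠ 0 := fun n hn ↦
    qPochInf_ne_zero (hpow n hn) h8
  have hne' : ∀ n, n ≠ 0 → qPochInf (-q ^ n) (q ^ 8) ≠ 0 := fun n hn ↦
    qPochInf_ne_zero (by simpa using hpow n hn) h8
  have f2 := hsq q
  have f6 := hsq (q ^ 3)
  have f10 := hsq (q ^ 5)
  have f14 := hsq (q ^ 7)
  simp only [← pow_mul] at f6 f10 f14
  norm_num at f6 f10 f14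
  have g1 := hsplit q
  have g1' := hsplit (-q)
  have g3 := hsplit (q ^ 3)
  have g3' := hsplit (-q ^ 3)
  rw [show q * q ^ 4 = q ^ 5 by ring] at g1
  rw [show -q * q ^ 4 = -q ^ 5 by ring, neg_neg] at g1'
  rw [show q ^ 3 * q ^ 4 = q ^ 7 by ring] at g3
  rw [show -q ^ 3 * q ^ 4 = -q ^ 7 by ring, neg_neg] at g3'
  have hx := vRam_eq hτ hq
  have hy := vRam_eq hτ2 hqq
  simp only [← pow_mul] at hy
  norm_num at hy
  rw [f2, f6, f10, f14, g1, g3'] at key₁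
  rw [f2, f6, f10, f14, g1', g3] at key₂
  have hx2 : vRam τ ^ 2 = q * (qPochInf q (q ^ 8) * (qPochInf (q ^ 5) (q ^ 8))⁻¹ *
      ((qPochInf (q ^ 3) (q ^ 8))⁻¹ * qPochInf (q ^ 7) (q ^ 8))) ^ 2 := by
    rw [hx, mul_pow, hhalf]
  rw [hx2, hy, hhalf2, f2, f6, f10, f14]
  have hR : qPochInf (q ^ 16) (q ^ 16) ≠ 0 :=
    qPochInf_ne_zero (hpow 16 (by norm_num)) (hpow 16 (by norm_num))
  have hb := hne 3 (by norm_num)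
  have hc := hne 5 (by norm_num)
  have hb' := hne' 3 (by norm_num)
  have hc' := hne' 5 (by norm_num)
  generalize qPochInf (q ^ 16) (q ^ 16) = R at *
  generalize qPochInf (-q ^ 4) (-q ^ 4) = P at *
  generalize qPochInf q (q ^ 8) = a at *
  generalize qPochInf (q ^ 3) (q ^ 8) = b at *
  generalize qPochInf (q ^ 5) (q ^ 8) = c at *
  generalize qPochInf (q ^ 7) (q ^ 8) = d at *
  generalize qPochInf (-q) (q ^ 8) = a' at *
  generalize qPochInf (-q ^ 3) (q ^ 8) = b' at *
  generalize qPochInf (-q ^ 5) (q ^ 8) = c' at *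
  generalize qPochInf (-q ^ 7) (q ^ 8) = d' at *
  have hmain : q * a ^ 2 * d ^ 2 * (b * b' * c * c') * (b * b' * c * c' + q * a * a' * d * d') =
      q * a * a' * d * d' * (b ^ 2 * c ^ 2) * (b * b' * c * c' - q * a * a' * d * d') := by
    refine mul_left_cancel₀ hR ?_
    linear_combination q * a * a' * d * d' * (b ^ 2 * c ^ 2) * key₁ -
      q * a ^ 2 * d ^ 2 * (b * b' * c * c') * key₂
  set N := b * b' * c * c' with hN
  set M := q * a * a' * d * d' with hM
  have hN0 : N ≠ 0 := by simp [hN, hb, hb', hc, hc']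
  have hy' : q * (a * a' * (c * c')⁻¹ * ((b * b')⁻¹ * (d * d'))) = M / N := by
    rw [hN, hM]; field_simp
  rw [hy']
  field_simp
  linear_combination hmain
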